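/- Generated-subgroup criterion for cohomology-class isomorphism over a general finite abelian group. Let Q be a finite group, p₁,…,p_k primes (not necessarily distinct), μ₁,…,μ_k ≥ 1, and A = ℤ/(p₁^{μ₁}) × … × ℤ/(p_k^{μ_k}). For a prime p, an exponent μ ≥ 1, and an index m ∈ {1,…,k}, define τ_m^{(p,μ)} : ℤ/(p_m^{μ_m}) → ℤ/(p^μ) to be the zero map if p_m ≠ p; the natural surjection (reduction modulo p^μ) if p_m = p and μ ≤ μ_m; and the injective homomorphism x ↦ p^{μ−μ_m}·x if p_m = p and μ > μ_m. For j = 1,2 let f_j : Q × Q → A be a normalized 2-cocycle for the trivial action with coordinate functions r_{j,m} = π_m ∘ f_j : Q × Q → ℤ/(p_m^{μ_m}), and let R_j^{(p,μ)} denote the subgroup of the abelian group of all functions Q × Q → ℤ/(p^μ) generated by the functions τ_m^{(p,μ)} ∘ r_{j,m} for m ∈ {1,…,k}. Then there exists α ∈ Aut(A) such that f₁ − α ∘ f₂ is a normalized 2-coboundary in B²(Q, A) if and only if for every i ∈ {1,…,k}, R₁^{(p_i,μ_i)} + B²(Q, ℤ/(p_i^{μ_i})) = R₂^{(p_i,μ_i)}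 + B²(Q, ℤ/(p_i^{μ_i})) as subgroups of the group of functions Q × Q → ℤ/(p_i^{μ_i}). -/

import Mathlib

/-- `f : Q × Q → A` is a normalized `2`-coboundary (for the trivial action). -/
def IsNormalizedCoboundary {Q : Type} [Group Q] {A : Type} [AddCommGroup A]
    (f : Q → Q → A) : Prop :=
  ∃ u : Q → A, u 1 = 0 ∧ ∀ p q, f p q = u p + u q - u (p * q)

/-- `B²(Q, A)` as a subgroup of the abelian group of all functions `Q × Q → A`. -/
def coboundaryAddSubgroup (Q : Type) [Group Q] (A : Type) [AddCommGroup A] :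
    AddSubgroup (Q → Q → A) where
  carrier := {f | IsNormalizedCoboundary f}
  add_mem' := by
    rintro f g ⟨u, hu0, hu⟩ ⟨v, hv0, hv⟩
    refine ⟨u + v, by simp [hu0, hv0], fun a b => ?_⟩
    simp only [Pi.add_apply, hu, hv]
    abel
  zero_mem' := ⟨0, rfl, by simp⟩
  neg_mem' := by
    rintro f ⟨u, hu0, hu⟩
    refine ⟨-u, by simp [hu0], fun a b => ?_⟩
    simp only [Pi.neg_apply, hu]
    abel

/-- The map `τ_m^{(p,μ)} : ℤ/(p_m^μ_m) → ℤ/(p^μ)`: the zero map if `p_m ≠ p`;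
the natural surjection (reduction mod `p^μ`) if `p_m = p` and `μ ≤ μ_m`;
and the injection `x ↦ p^{μ−μ_m}·x` if `p_m = p` and `μ > μ_m`.
Here the target is specified by an index `i`, i.e. `(p, μ) = (p i, μ i)`. -/
def tau (k : ℕ) (p μ : Fin k → ℕ) (i m : Fin k)
    (x : ZMod (p m ^ μ m)) : ZMod (p i ^ μ i) :=
  if p m = p i then
    (if μ i ≤ μ m then ((x.val : ZMod (p i ^ μ i)))
      else ((p i : ZMod (p i ^ μ i)) ^ (μ i - μ m)) * (x.val : ZMod (p i ^ μ i)))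
  else 0

/-- A ring is unit-regular if every element `a` satisfies `a * u * a = a` for a unit `u`. -/
def IsUnitRegular (R : Type*) [Ring R] : Prop :=
  ∀ a : R, ∃ u : Rˣ, a * u * a = a

theorem IsUnitRegular.of_ringEquiv {R S : Type*} [Ring R] [Ring S] (e : R ≃+* S)
    (h : IsUnitRegular S) : IsUnitRegular R := by
  intro a
  obtain ⟨u, hu⟩ := h (e a)
  refine ⟨Units.map (e.symm : S →* R) u, e.injective ?_⟩
  simpa using hu

theorem IsUnitRegular.pi {ι : Type*} {R : ι → Type*} [∀ i, Ring (R i)]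
    (h : ∀ i, IsUnitRegular (R i)) : IsUnitRegular (∀ i, R i) := by
  intro a
  choose u hu using fun i => h i (a i)
  exact ⟨MulEquiv.piUnits.symm u, funext hu⟩

theorem isUnitRegular_end {K V : Type*} [DivisionRing K] [AddCommGroup V] [Module K V]
    [FiniteDimensional K V] : IsUnitRegular (Module.End K V) := by
  intro a
  obtain ⟨W, hW⟩ := (LinearMap.ker a).exists_isCompl
  obtain ⟨C, hC⟩ := (LinearMap.range a).exists_isCompl
  have hdim : Module.finrank K (LinearMap.ker a) = Module.finrank K C := by
    have h₁ := LinearMap.finrank_range_add_finrank_ker a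
    have h₂ := Submodule.finrank_add_eq_of_isCompl hC
    lia
  let φ := LinearEquiv.ofFinrankEq _ _ hdim
  let π := (LinearMap.ker a).projectionOnto W hW
  let g : Module.End K V := a + C.subtype ∘ₗ φ.toLinearMap ∘ₗ π
  have hg : ∀ v, g v = a v + (φ (π v) : V) := fun v => rfl
  have hinj : Function.Injective g := by
    rw [← LinearMap.ker_eq_bot, LinearMap.ker_eq_bot']
    intro v hv
    rw [hg] at hv
    have hmem : (φ (π v) : V) ∈ LinearMap.range a ⊓ C :=
      ⟨⟨-v, by rw [map_neg, neg_eq_iff_add_eq_zero, hv]⟩, (φ (π v)).2⟩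
    rw [hC.inf_eq_bot, Submodule.mem_bot] at hmem
    rw [hmem, add_zero] at hv
    have hπ : π v = 0 := by simpa using hmem
    have hπv : π v = ⟨v, hv⟩ := Submodule.projectionOnto_apply_left hW ⟨v, hv⟩
    simpa using congrArg Subtype.val (hπv.symm.trans hπ)
  have hunit : IsUnit g := (Module.End.isUnit_iff g).2
    ⟨hinj, LinearMap.injective_iff_surjective.1 hinj⟩
  obtain ⟨u, hu⟩ := hunit
  refine ⟨u⁻¹, LinearMap.ext fun v => ?_⟩
  have hav : a v = g (v - (π v : V)) := by
    have hk : a (π v : V) = 0 := (π v).2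
    have hππ : π (π v : V) = π v := Submodule.projectionOnto_apply_left hW (π v)
    rw [hg, map_sub, map_sub, hππ, hk]
    simp
  have hinv : ∀ w, (↑u⁻¹ : Module.End K V) (g w) = w := fun w => by
    rw [← hu, ← Module.End.mul_apply, Units.inv_mul, Module.End.one_apply]
  have hk : a (π v : V) = 0 := (π v).2
  rw [Module.End.mul_apply, Module.End.mul_apply, hav, hinv, ← hav, map_sub, hk, sub_zero]

theorem isUnitRegular_matrix {D : Type*} [DivisionRing D] (n : ℕ) :
    IsUnitRegular (Matrix (Fin n) (Fin n) D) := by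
  intro A
  obtain ⟨u, hu⟩ := isUnitRegular_end (Matrix.toLinearMapRight' A)
  have hmul (f g : Module.End D (Fin n → D)) : LinearMap.toMatrixRight' (f * g)
      = LinearMap.toMatrixRight' g * LinearMap.toMatrixRight' f :=
    Matrix.toLinearMapRight'.injective <| by
      simp [Matrix.toLinearMapRight'_mul, Module.End.mul_eq_comp]
  have hone : LinearMap.toMatrixRight' (1 : Module.End D (Fin n → D)) = 1 :=
    Matrix.toLinearMapRight'.injective <| by simp [Module.End.one_eq_id]
  refine ⟨⟨LinearMap.toMatrixRight' ↑u, LinearMap.toMatrixRight' ↑u⁻¹, ?_, ?_⟩, ?_⟩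
  · rw [← hmul, Units.inv_mul, hone]
  · rw [← hmul, Units.mul_inv, hone]
  · have h := congrArg LinearMap.toMatrixRight' hu
    rwa [hmul, hmul, LinearEquiv.apply_symm_apply, ← mul_assoc] at h

theorem isUnitRegular_of_isSemisimpleRing (R : Type*) [Ring R] [IsSemisimpleRing R] :
    IsUnitRegular R := by
  obtain ⟨n, D, d, _, _, ⟨e⟩⟩ := IsSemisimpleRing.exists_ringEquiv_pi_matrix_divisionRing R
  exact .of_ringEquiv e (.pi fun i => isUnitRegular_matrix (d i))

theorem IsUnitRegular.exists_isUnit_add_mul {R : Type*} [Ring R] (h : IsUnitRegular R)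
    (a b : R) : ∃ t, IsUnit (a + t * (1 - b * a)) := by
  obtain ⟨u, hu⟩ := h a
  have hs : a + ↑u⁻¹ * (1 - u * a) * (1 - b * a) = ↑u⁻¹ * (1 - (1 - u * a) * (b * a)) := by
    simp only [mul_sub, sub_mul, ← mul_assoc, Units.inv_mul, one_mul, mul_one]
    abel
  have hz : a * (1 - u * a) = 0 := by rw [mul_sub, ← mul_assoc, hu, mul_one, sub_self]
  refine ⟨↑u⁻¹ * (1 - u * a), ?_⟩
  rw [hs]
  refine u⁻¹.isUnit.mul (IsNilpotent.isUnit_one_sub ⟨2, ?_⟩)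
  calc ((1 - u * a) * (b * a)) ^ 2
      = (1 - u * a) * b * (a * (1 - u * a)) * (b * a) := by simp only [sq, mul_assoc]
    _ = 0 := by rw [hz, mul_zero, zero_mul]

theorem isUnit_of_isUnit_mk_jacobson {R : Type*} [Ring R] [Finite R] {x : R}
    (h : IsUnit (Ideal.Quotient.mk (Ring.jacobson R) x)) : IsUnit x := by
  obtain ⟨y, hy⟩ := h.exists_right_inv
  obtain ⟨y, rfl⟩ := Ideal.Quotient.mk_surjective y
  rw [← map_mul, ← map_one (Ideal.Quotient.mk _), Ideal.Quotient.mk_eq_mk_iff_sub_mem] at hy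
  have htop : Ideal.span {x * y} = ⊤ := by
    by_contra hne
    obtain ⟨M, hM, hle⟩ := Ideal.exists_le_maximal _ hne
    have hxy : x * y ∈ M := hle (Ideal.mem_span_singleton_self _)
    refine hM.ne_top ((Ideal.eq_top_iff_one M).2 ?_)
    simpa using M.sub_mem hxy (Ring.jacobson_le_of_isMaximal M hy)
  obtain ⟨z, hz⟩ := Ideal.mem_span_singleton'.1 ((Ideal.eq_top_iff_one _).1 htop)
  exact .of_mul_eq_one (y * z) (by rw [← mul_assoc, mul_eq_one_comm.1 hz])

/-- A finite ring has stable rank one. -/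
theorem exists_isUnit_add_mul_of_finite {R : Type*} [Ring R] [Finite R] (a b : R) :
    ∃ t, IsUnit (a + t * (1 - b * a)) := by
  obtain ⟨t, ht⟩ := (isUnitRegular_of_isSemisimpleRing (R ⧸ Ring.jacobson R)).exists_isUnit_add_mul
    (Ideal.Quotient.mk _ a) (Ideal.Quotient.mk _ b)
  obtain ⟨t, rfl⟩ := Ideal.Quotient.mk_surjective t
  exact ⟨t, isUnit_of_isUnit_mk_jacobson (by simpa using ht)⟩

theorem IsNormalizedCoboundary.map {Q A B : Type} [Group Q] [AddCommGroup A] [AddCommGroup B]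
    (φ : A →+ B) {f : Q → Q → A} (h : IsNormalizedCoboundary f) :
    IsNormalizedCoboundary fun a b => φ (f a b) := by
  obtain ⟨u, hu₀, hu⟩ := h
  exact ⟨fun q => φ (u q), by simp [hu₀], fun a b => by simp [hu]⟩

theorem IsNormalizedCoboundary.pi {Q ι : Type} {A : ι → Type} [Group Q]
    [∀ i, AddCommGroup (A i)] {f : Q → Q → ∀ i, A i}
    (h : ∀ i, IsNormalizedCoboundary fun a b => f a b i) : IsNormalizedCoboundary f := by
  choose u hu₀ hu using h
  exact ⟨fun q i => u i q, funext hu₀, fun a b => funext fun i => hu i a b⟩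

theorem IsNormalizedCoboundary.add {Q A : Type} [Group Q] [AddCommGroup A] {f g : Q → Q → A}
    (hf : IsNormalizedCoboundary f) (hg : IsNormalizedCoboundary g) :
    IsNormalizedCoboundary (f + g) :=
  (coboundaryAddSubgroup Q A).add_mem hf hg

theorem IsNormalizedCoboundary.neg {Q A : Type} [Group Q] [AddCommGroup A] {f : Q → Q → A}
    (hf : IsNormalizedCoboundary f) : IsNormalizedCoboundary (-f) :=
  (coboundaryAddSubgroup Q A).neg_mem hf

/-- Two functions into a finite abelian group that are images of each other under endomorphisms,
modulo coboundaries, are related by an automorphism. -/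
theorem exists_addAut_of_addMonoidEnd {Q A : Type} [Group Q] [AddCommGroup A] [Finite A]
    {f₁ f₂ : Q → Q → A} (φ ψ : AddMonoid.End A)
    (hφ : IsNormalizedCoboundary fun a b => f₁ a b - φ (f₂ a b))
    (hψ : IsNormalizedCoboundary fun a b => f₂ a b - ψ (f₁ a b)) :
    ∃ α : AddAut A, IsNormalizedCoboundary fun a b => f₁ a b - α (f₂ a b) := by
  have : Finite (AddMonoid.End A) := DFunLike.finite (A →+ A)
  obtain ⟨t, u, hu⟩ := exists_isUnit_add_mul_of_finite φ ψ
  have huv : ∀ x, (u : AddMonoid.End A) x = φ x + t (x - ψ (φ x)) := fun x => by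
    rw [hu]; rfl
  have hinv : ∀ x, (↑u⁻¹ : AddMonoid.End A) ((u : AddMonoid.End A) x) = x := fun x =>
    DFunLike.congr_fun u.inv_mul x
  have hinv' : ∀ x, (u : AddMonoid.End A) ((↑u⁻¹ : AddMonoid.End A) x) = x := fun x =>
    DFunLike.congr_fun u.mul_inv x
  let α : AddAut A :=
    { (u : AddMonoid.End A) with invFun := (↑u⁻¹ : AddMonoid.End A)
                                 left_inv := hinv, right_inv := hinv' }
  refine ⟨α, ?_⟩
  have hcomb : IsNormalizedCoboundary fun a b => f₁ a b - φ (f₂ a b)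
      + -t (f₂ a b - ψ (f₁ a b) + ψ (f₁ a b - φ (f₂ a b))) :=
    hφ.add ((hψ.add (hφ.map ψ)).map t).neg
  convert hcomb using 1
  funext a b
  change f₁ a b - (u : AddMonoid.End A) (f₂ a b) = _
  rw [huv]
  simp only [map_add, map_sub]
  abel

/-- The annihilator of `p ^ a` in `ZMod (q ^ b)`, for primes `p` and `q`, is generated by the value
of the comparison map at `1`. -/
theorem ZMod.exists_nsmul_eq_of_pow_nsmul_eq_zero {p q a b : ℕ} (hp : p.Prime) (hq : q.Prime)
    (c : ZMod (q ^ b)) (hc : p ^ a • c = 0) :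
    ∃ n : ℕ, c = n • (if p = q then (if b ≤ a then 1 else (q : ZMod (q ^ b)) ^ (b - a)) else 0) := by
  have : NeZero (q ^ b) := ⟨(pow_pos hq.pos b).ne'⟩
  split_ifs with hpq hba
  · exact ⟨c.val, by simp⟩
  · subst hpq
    have hdvd : p ^ b ∣ p ^ a * c.val := by
      rw [← ZMod.natCast_eq_zero_iff]
      simpa using hc
    have hsplit : p ^ b = p ^ a * p ^ (b - a) := by rw [← pow_add]; congr 1; lia
    obtain ⟨n, hn⟩ := Nat.dvd_of_mul_dvd_mul_left (pow_pos hp.pos a) ((dvd_of_eq hsplit.symm).trans hdvd)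
    refine ⟨n, ?_⟩
    rw [← ZMod.natCast_zmod_val c, hn]
    simp [mul_comm]
  · refine ⟨0, ?_⟩
    have hdvd : q ^ b ∣ p ^ a * c.val := by
      rw [← ZMod.natCast_eq_zero_iff]
      simpa using hc
    have hcop : (q ^ b).Coprime (p ^ a) :=
      Nat.Coprime.pow _ _ ((Nat.coprime_primes hq hp).2 (Ne.symm hpq))
    rw [← ZMod.natCast_zmod_val c, (ZMod.natCast_eq_zero_iff _ _).2 (hcop.dvd_of_dvd_mul_left hdvd)]
    simp

section Tau

variable {k : ℕ} {p μ : Fin k → ℕ}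

theorem tau_eq_val_nsmul (i m : Fin k) (x : ZMod (p m ^ μ m)) :
    tau k p μ i m x = x.val • (if p m = p i then
      (if μ i ≤ μ m then 1 else (p i : ZMod (p i ^ μ i)) ^ (μ i - μ m)) else 0) := by
  unfold tau
  split_ifs <;> simp [mul_comm]

theorem tau_self (hp : ∀ i, (p i).Prime) (i : Fin k) (x : ZMod (p i ^ μ i)) :
    tau k p μ i i x = x := by
  have : NeZero (p i ^ μ i) := ⟨(pow_pos (hp i).pos _).ne'⟩
  simp [tau]

theorem exists_addMonoidHom_eq_tau (hp : ∀ i, (p i).Prime) (i m : Fin k) :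
    ∃ T : ZMod (p m ^ μ m) →+ ZMod (p i ^ μ i), ∀ x, T x = tau k p μ i m x := by
  have : NeZero (p m ^ μ m) := ⟨(pow_pos (hp m).pos _).ne'⟩
  set c : ZMod (p i ^ μ i) := if p m = p i then
      (if μ i ≤ μ m then 1 else (p i : ZMod (p i ^ μ i)) ^ (μ i - μ m)) else 0 with hc
  have hkill : (p m ^ μ m) • c = 0 := by
    rw [hc]
    split_ifs with h hle
    · rw [nsmul_one, ZMod.natCast_eq_zero_iff, h]
      exact pow_dvd_pow _ hle
    · rw [nsmul_eq_mul, h, ← Nat.cast_pow, ← Nat.cast_mul, ZMod.natCast_eq_zero_iff, ← pow_add]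
      exact pow_dvd_pow _ (by lia)
    · exact smul_zero _
  refine ⟨ZMod.lift _ ⟨zmultiplesHom _ c, (natCast_zsmul c _).trans hkill⟩, fun x => ?_⟩
  have hx := ZMod.lift_coe (p m ^ μ m)
    ⟨zmultiplesHom _ c, (natCast_zsmul c _).trans hkill⟩ (x.val : ℤ)
  rw [Int.cast_natCast, ZMod.natCast_zmod_val] at hx
  rw [tau_eq_val_nsmul, ← hc, hx]
  exact natCast_zsmul c _

theorem exists_eq_nsmul_tau (hp : ∀ i, (p i).Prime) (i m : Fin k)
    (φ : ZMod (p m ^ μ m) →+ ZMod (p i ^ μ i)) : ∃ n : ℕ, ∀ x, φ x = n • tau k p μ i m x := by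
  have : NeZero (p m ^ μ m) := ⟨(pow_pos (hp m).pos _).ne'⟩
  have hkill : (p m ^ μ m) • φ 1 = 0 := by
    rw [← map_nsmul, nsmul_one, ZMod.natCast_self, map_zero]
  obtain ⟨n, hn⟩ := ZMod.exists_nsmul_eq_of_pow_nsmul_eq_zero (hp m) (hp i) _ hkill
  refine ⟨n, fun x => ?_⟩
  rw [tau_eq_val_nsmul, smul_comm, ← hn, ← map_nsmul, nsmul_one, ZMod.natCast_zmod_val]

theorem comp_mem_closure_tau {Q : Type} (hp : ∀ i, (p i).Prime) (i : Fin k)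
    (f : Q → Q → ∀ m, ZMod (p m ^ μ m)) (φ : (∀ m, ZMod (p m ^ μ m)) →+ ZMod (p i ^ μ i)) :
    (fun a b => φ (f a b)) ∈ AddSubgroup.closure
      (Set.range fun m : Fin k => (fun a b : Q => tau k p μ i m (f a b m))) := by
  choose n hn using fun m => exists_eq_nsmul_tau hp i m (φ.comp (AddMonoidHom.single (fun m => ZMod (p m ^ μ m)) m))
  have hsum : (fun a b => φ (f a b)) = ∑ m, n m • fun a b : Q => tau k p μ i m (f a b m) := by
    funext a b
    simp only [Finset.sum_apply, Pi.smul_apply, ← hn, AddMonoidHom.comp_apply, ← map_sum]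
    exact congrArg φ (Finset.univ_sum_single (f a b)).symm
  rw [hsum]
  exact sum_mem fun m _ => nsmul_mem (AddSubgroup.subset_closure (Set.mem_range_self m)) _

theorem exists_hom_of_mem_closure_tau {Q : Type} (hp : ∀ i, (p i).Prime) (i : Fin k)
    (f : Q → Q → ∀ m, ZMod (p m ^ μ m)) {g : Q → Q → ZMod (p i ^ μ i)}
    (hg : g ∈ AddSubgroup.closure
      (Set.range fun m : Fin k => (fun a b : Q => tau k p μ i m (f a b m)))) :
    ∃ φ : (∀ m, ZMod (p m ^ μ m)) →+ ZMod (p i ^ μ i), ∀ a b, g a b = φ (f a b) := by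
  induction hg using AddSubgroup.closure_induction with
  | mem g hg =>
    obtain ⟨m, rfl⟩ := hg
    obtain ⟨T, hT⟩ := exists_addMonoidHom_eq_tau (μ := μ) hp i m
    exact ⟨T.comp (Pi.evalAddMonoidHom _ m), fun a b => (hT _).symm⟩
  | zero => exact ⟨0, fun _ _ => rfl⟩
  | add g h _ _ ihg ihh =>
    obtain ⟨φ, hφ⟩ := ihg
    obtain ⟨ψ, hψ⟩ := ihh
    exact ⟨φ + ψ, fun a b => by simp [hφ, hψ]⟩
  | neg g _ ih =>
    obtain ⟨φ, hφ⟩ := ih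
    exact ⟨-φ, fun a b => by simp [hφ]⟩

/-- If `f₁` is the image of `f₂` under an endomorphism modulo coboundaries, then the subgroup
attached to `f₁` is contained in the one attached to `f₂`. -/
theorem closure_tau_sup_le {Q : Type} [Group Q] (hp : ∀ i, (p i).Prime) (i : Fin k)
    {f₁ f₂ : Q → Q → ∀ m, ZMod (p m ^ μ m)} (φ : AddMonoid.End (∀ m, ZMod (p m ^ μ m)))
    (h : IsNormalizedCoboundary fun a b => f₁ a b - φ (f₂ a b)) :
    AddSubgroup.closure (Set.range fun m : Fin k => (fun a b : Q => tau k p μ i m (f₁ a b m)))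
        ⊔ coboundaryAddSubgroup Q (ZMod (p i ^ μ i))
      ≤ AddSubgroup.closure (Set.range fun m : Fin k => (fun a b : Q => tau k p μ i m (f₂ a b m)))
        ⊔ coboundaryAddSubgroup Q (ZMod (p i ^ μ i)) := by
  refine sup_le ((AddSubgroup.closure_le _).2 ?_) le_sup_right
  rintro _ ⟨m, rfl⟩
  obtain ⟨T, hT⟩ := exists_addMonoidHom_eq_tau (μ := μ) hp i m
  let θ := T.comp (Pi.evalAddMonoidHom (fun m => ZMod (p m ^ μ m)) m)
  have hsum := AddSubgroup.add_mem_sup (comp_mem_closure_tau hp i f₂ (θ.comp φ))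
    (show _ ∈ coboundaryAddSubgroup Q (ZMod (p i ^ μ i)) from h.map θ)
  rw [SetLike.mem_coe]
  convert hsum using 1
  funext a b
  change tau k p μ i m (f₁ a b m) = θ (φ (f₂ a b)) + θ (f₁ a b - φ (f₂ a b))
  rw [map_sub, add_sub_cancel]
  exact (hT _).symm

theorem exists_end_of_closure_tau_sup_le {Q : Type} [Group Q] (hp : ∀ i, (p i).Prime)
    {f₁ f₂ : Q → Q → ∀ m, ZMod (p m ^ μ m)}
    (h : ∀ i, AddSubgroup.closure
          (Set.range fun m : Fin k => (fun a b : Q => tau k p μ i m (f₁ a b m)))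
        ⊔ coboundaryAddSubgroup Q (ZMod (p i ^ μ i))
      ≤ AddSubgroup.closure (Set.range fun m : Fin k => (fun a b : Q => tau k p μ i m (f₂ a b m)))
        ⊔ coboundaryAddSubgroup Q (ZMod (p i ^ μ i))) :
    ∃ φ : AddMonoid.End (∀ m, ZMod (p m ^ μ m)),
      IsNormalizedCoboundary fun a b => f₁ a b - φ (f₂ a b) := by
  have hcoord : ∀ i, ∃ φ : (∀ m, ZMod (p m ^ μ m)) →+ ZMod (p i ^ μ i),
      IsNormalizedCoboundary fun a b => f₁ a b i - φ (f₂ a b) := by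
    intro i
    have hmem := h i (AddSubgroup.mem_sup_left (AddSubgroup.subset_closure ⟨i, rfl⟩))
    obtain ⟨g, hg, c, hc, hgc⟩ := AddSubgroup.mem_sup.1 hmem
    obtain ⟨φ, hφ⟩ := exists_hom_of_mem_closure_tau hp i f₂ hg
    refine ⟨φ, ?_⟩
    convert (show IsNormalizedCoboundary c from hc) using 1
    funext a b
    have hab : g a b + c a b = tau k p μ i i (f₁ a b i) := congrFun (congrFun hgc a) b
    rw [tau_self hp] at hab
    rw [← hab, hφ, add_sub_cancel_left]
  choose φ hφ using hcoord
  exact ⟨AddMonoidHom.mk' (fun x i => φ i x) fun x y => funext fun i => map_add (φ i) x y, .pi hφ⟩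

end Tau

/-- **Generated-subgroup criterion for cohomology-class isomorphism over a general
finite abelian group.** For `A = ℤ/(p₁^μ₁) × … × ℤ/(p_k^μ_k)` and normalized
`2`-cocycles `f₁, f₂ : Q × Q → A` (trivial action), with `Rⱼ^{(pᵢ,μᵢ)}` the subgroup
generated by the images under `τ` of the coordinate functions of `fⱼ`, there exists
`α ∈ Aut(A)` with `f₁ − α ∘ f₂` a normalized `2`-coboundary iff
`R₁^{(pᵢ,μᵢ)} + B²(Q, ℤ/(pᵢ^μᵢ)) = R₂^{(pᵢ,μᵢ)} + B²(Q, ℤ/(pᵢ^μᵢ))` for every `i`. -/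
theorem general_abelian_rowspan_criterion
    (Q : Type) [Group Q] [Finite Q]
    (k : ℕ) (p μ : Fin k → ℕ)
    (hp : ∀ i, (p i).Prime) (hμ : ∀ i, 1 ≤ μ i)
    (f₁ f₂ : Q → Q → (∀ m : Fin k, ZMod (p m ^ μ m)))
    (hnorm₁ : ∀ q, f₁ 1 q = 0 ∧ f₁ q 1 = 0)
    (hnorm₂ : ∀ q, f₂ 1 q = 0 ∧ f₂ q 1 = 0)
    (hcoc₁ : ∀ a b c, f₁ a b + f₁ (a * b) c = f₁ b c + f₁ a (b * c))
    (hcoc₂ : ∀ a b c, f₂ a b + f₂ (a * b) c = f₂ b c + f₂ a (b * c)) :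
    (∃ α : AddAut (∀ m : Fin k, ZMod (p m ^ μ m)),
        IsNormalizedCoboundary (fun a b => f₁ a b - α (f₂ a b))) ↔
      ∀ i : Fin k,
        AddSubgroup.closure
            (Set.range fun m : Fin k => (fun a b : Q => tau k p μ i m (f₁ a b m)))
          ⊔ coboundaryAddSubgroup Q (ZMod (p i ^ μ i))
        = AddSubgroup.closure
            (Set.range fun m : Fin k => (fun a b : Q => tau k p μ i m (f₂ a b m)))
          ⊔ coboundaryAddSubgroup Q (ZMod (p i ^ μ i)) := by
  constructor
  · rintro ⟨α, hα⟩ i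
    refine le_antisymm (closure_tau_sup_le hp i α.toAddMonoidHom hα)
      (closure_tau_sup_le hp i α.symm.toAddMonoidHom ?_)
    convert (hα.map α.symm.toAddMonoidHom).neg using 1
    funext a b
    simp
    rfl
  · intro h
    have (m : Fin k) : NeZero (p m ^ μ m) := ⟨(pow_pos (hp m).pos _).ne'⟩
    obtain ⟨φ, hφ⟩ := exists_end_of_closure_tau_sup_le hp fun i => (h i).le
    obtain ⟨ψ, hψ⟩ := exists_end_of_closure_tau_sup_le hp fun i => (h i).ge
    exact exists_addAut_of_addMonoidEnd φ ψ hφ hψ
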